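/- Let R be a commutative ring, let F_• → R and G_• → R be complexes of free R-modules, and let q_• : F_•[shift] → G_• be a morphism of complexes as in a mapping cone setup. For each k > 0 suppose the short exact sequences 0 → ker q_k → F_k → im q_k → 0 and 0 → im q_k → G_k → coker q_k → 0 are split, and coker q_1 = 0. Then the mapping cone of q is isomorphic, as a complex, to the direct sum of a split exact complex and the complex with terms A_{k−1} ⊕ C_k (where A_k = ker q_k, C_k = coker q_k) and differentials given by the induced maps together with the connecting map Θ_k : C_k → A_{k−2} defined as the composite C_k → G_k → G_{k−1} → B_{k−1} → F_{k−1} → F_{k−2} → A_{k−2} using splittings. -/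

import Mathlib

open LinearMap

namespace Stmt11

variable {R : Type} [CommRing R]
variable {F G : ℕ → Type}
variable [∀ kk, AddCommGroup (F kk)] [∀ kk, Module R (F kk)]
variable [∀ kk, AddCommGroup (G kk)] [∀ kk, Module R (G kk)]

variable (d : ∀ kk, F (kk + 1) →ₗ[R] F kk) (m : ∀ kk, G (kk + 1) →ₗ[R] G kk)
variable (q : ∀ kk, F kk →ₗ[R] G kk) (σ : ∀ kk, G kk →ₗ[R] F kk)

/-- The idempotent-to-be `e_k = q_k ∘ σ_k : G_k → G_k`; its image is `B_k = im q_k`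
and its kernel is the chosen complement, a model for `C_k = coker q_k`. -/
def eMap (kk : ℕ) : G kk →ₗ[R] G kk := (q kk).comp (σ kk)

/-- Differential of the mapping cone of `q` (in cone degree `kk+2 → kk+1`, where the
cone has `G 0` in degree `0` and `F kk × G (kk+1)` in degree `kk+1`). -/
def cnD (kk : ℕ) : (F (kk + 1) × G (kk + 2)) →ₗ[R] (F kk × G (kk + 1)) :=
  LinearMap.prod ((d kk).comp (LinearMap.fst R (F (kk + 1)) (G (kk + 2))))
    ((q (kk + 1)).coprod (-(m (kk + 1))))

/-- Bottom differential of the mapping cone, in cone degree `1 → 0`. -/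
def cnD0 : (F 0 × G 1) →ₗ[R] G 0 := (q 0).coprod (-(m 0))

/-- The terms of the complex `D` of Miller–Rahmati type, indexed so that `DObj kk`
sits in cone degree `kk + 1`:  `D_1 = F_0` and `D_{j+2} = A_{j+1} ⊕ C_{j+2}`, where
`A_k = ker q_k` and `C_k` is the chosen complement `ker e_k` of `B_k = im q_k`
(a model for `coker q_k` furnished by the splitting). -/
def DObj : ℕ → Type
  | 0 => F 0
  | (j + 1) => ↥(LinearMap.ker (q (j + 1))) × ↥(LinearMap.ker (eMap q σ (j + 2)))

instance : ∀ kk, AddCommGroup (DObj q σ kk)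
  | 0 => inferInstanceAs (AddCommGroup (F 0))
  | (j + 1) => inferInstanceAs (AddCommGroup
      (↥(LinearMap.ker (q (j + 1))) × ↥(LinearMap.ker (eMap q σ (j + 2)))))

instance : ∀ kk, Module R (DObj q σ kk)
  | 0 => inferInstanceAs (Module R (F 0))
  | (j + 1) => inferInstanceAs (Module R
      (↥(LinearMap.ker (q (j + 1))) × ↥(LinearMap.ker (eMap q σ (j + 2)))))

variable (hq : ∀ kk, (q kk).comp (d kk) = (m kk).comp (q (kk + 1)))
variable (hσ : ∀ kk, (q (kk + 1)).comp ((σ (kk + 1)).comp (q (kk + 1))) = q (kk + 1))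

/-- The induced differential `A_{j+2} → A_{j+1}` on kernels. -/
def dA (j : ℕ) : ↥(LinearMap.ker (q (j + 2))) →ₗ[R] ↥(LinearMap.ker (q (j + 1))) :=
  (d (j + 1)).restrict (fun x hx => by
    have h := congrArg (fun φ => φ x) (hq (j + 1))
    simp only [LinearMap.comp_apply] at h
    simp only [LinearMap.mem_ker] at hx ⊢
    rw [h, hx, map_zero])

/-- Projection of `G_{j+1}` onto the complement `C_{j+1} = ker e_{j+1}` along
`B_{j+1}`, i.e. `1 − e`. -/
def piC (j : ℕ) : G (j + 1) →ₗ[R] ↥(LinearMap.ker (eMap q σ (j + 1))) :=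
  LinearMap.codRestrict _ (LinearMap.id - eMap q σ (j + 1)) (fun c => by
    simp only [LinearMap.mem_ker, eMap, LinearMap.comp_apply, LinearMap.sub_apply,
      LinearMap.id_apply, map_sub]
    have h := congrArg (fun φ => φ (σ (j + 1) c)) (hσ j)
    simp only [LinearMap.comp_apply] at h
    rw [h]
    exact sub_self _)

/-- The induced differential `C_{j+2} → C_{j+1}` on cokernel models. -/
def mC (j : ℕ) :
    ↥(LinearMap.ker (eMap q σ (j + 2))) →ₗ[R] ↥(LinearMap.ker (eMap q σ (j + 1))) :=
  (piC q σ hσ j).comp ((m (j + 1)).comp (Submodule.subtype _))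

/-- Projection of `F_{j+1}` onto `A_{j+1} = ker q_{j+1}` along the image of the
splitting, i.e. `1 − σ∘q`. -/
def piA (j : ℕ) : F (j + 1) →ₗ[R] ↥(LinearMap.ker (q (j + 1))) :=
  LinearMap.codRestrict _ (LinearMap.id - (σ (j + 1)).comp (q (j + 1))) (fun x => by
    simp only [LinearMap.mem_ker, LinearMap.sub_apply, LinearMap.id_apply,
      LinearMap.comp_apply, map_sub]
    have h := congrArg (fun φ => φ x) (hσ j)
    simp only [LinearMap.comp_apply] at h
    rw [h]
    exact sub_self _)

/-- The connecting map `Θ : C_{j+3} → A_{j+1}`, the composite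
`C → G → G → B → F → F → A` of the inclusion, `m`, the projection onto `B`
followed by the inclusion `B → F` (both via the splitting, i.e. `σ ∘ e`), the
differential `d`, and the projection onto `A`. -/
def Theta (j : ℕ) :
    ↥(LinearMap.ker (eMap q σ (j + 3))) →ₗ[R] ↥(LinearMap.ker (q (j + 1))) :=
  (piA q σ hσ j).comp ((d (j + 1)).comp (((σ (j + 2)).comp ((eMap q σ (j + 2)).comp
    (m (j + 2)))).comp (Submodule.subtype _)))

/-- The connecting map `Θ_2 : C_2 → F_0` at the bottom of the complex `D`
(no final projection, since the bottom term is all of `F_0`). -/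
def ThetaTop : ↥(LinearMap.ker (eMap q σ 2)) →ₗ[R] F 0 :=
  (d 0).comp (((σ 1).comp ((eMap q σ 1).comp (m 1))).comp (Submodule.subtype _))

/-- The differential of the complex `D`: in matrix form `[[d, Θ], [0, −m̄]]`, and
`(d_1, Θ_2) : A_1 ⊕ C_2 → F_0` at the bottom. -/
def Dd : ∀ kk, DObj q σ (kk + 1) →ₗ[R] DObj q σ kk
  | 0 => LinearMap.coprod ((d 0).comp (Submodule.subtype _)) (ThetaTop d m q σ)
  | (j + 1) =>
      LinearMap.prod
        (LinearMap.coprod (dA d m q hq j) (Theta d m q σ hσ j))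
        ((-(mC m q σ hσ (j + 1))).comp
          (LinearMap.snd R (↥(LinearMap.ker (q (j + 2))))
            (↥(LinearMap.ker (eMap q σ (j + 3))))))

/-- The splitting normalized to vanish on the complement of `im q_k`, i.e. `σ ∘ e`. -/
def normSplit (kk : ℕ) : G kk →ₗ[R] F kk := (σ kk).comp (eMap q σ kk)

/-- The degree `+1` map `(x, y) ↦ (σ e y, 0)` on the mapping cone. -/
def coneHtpy (kk : ℕ) : (F kk × G (kk + 1)) →ₗ[R] (F (kk + 1) × G (kk + 2)) :=
  (LinearMap.inl R (F (kk + 1)) (G (kk + 2))).comp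
    ((normSplit q σ (kk + 1)).comp (LinearMap.snd R (F kk) (G (kk + 1))))

/-- The endomorphism `D H + H D` of the mapping cone attached to `H = coneHtpy`. -/
def coneProj : ∀ kk, (F kk × G (kk + 1)) →ₗ[R] (F kk × G (kk + 1))
  | 0 => (cnD d m q 0).comp (coneHtpy q σ 0)
  | (j + 1) => (cnD d m q (j + 1)).comp (coneHtpy q σ (j + 1)) +
      (coneHtpy q σ j).comp (cnD d m q j)

/-- The map from the mapping cone to the complex `D` given by the projections onto
`A_{k-1}` and `C_k`. -/
def toDObj : ∀ kk, (F kk × G (kk + 1)) →ₗ[R] DObj q σ kk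
  | 0 => LinearMap.fst R (F 0) (G 1)
  | (j + 1) => LinearMap.prodMap (piA q σ hσ j) (piC q σ hσ (j + 1))

section

variable {d m q σ}

lemma cnD_apply (kk : ℕ) (z : F (kk + 1) × G (kk + 2)) :
    cnD d m q kk z = (d kk z.1, q (kk + 1) z.1 - m (kk + 1) z.2) := by
  simp [cnD, sub_eq_add_neg]

lemma coneHtpy_apply (kk : ℕ) (z : F kk × G (kk + 1)) :
    coneHtpy q σ kk z = (normSplit q σ (kk + 1) z.2, 0) := rfl

lemma cnD_cnD (hdd : ∀ kk, (d kk).comp (d (kk + 1)) = 0)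
    (hmm : ∀ kk, (m kk).comp (m (kk + 1)) = 0)
    (hq : ∀ kk, (q kk).comp (d kk) = (m kk).comp (q (kk + 1)))
    (kk : ℕ) (z : F (kk + 2) × G (kk + 3)) :
    cnD d m q kk (cnD d m q (kk + 1) z) = 0 := by
  have h₁ := LinearMap.congr_fun (hdd kk) z.1
  have h₂ := LinearMap.congr_fun (hmm (kk + 1)) z.2
  have h₃ := LinearMap.congr_fun (hq (kk + 1)) z.1
  simp only [LinearMap.comp_apply, LinearMap.zero_apply] at h₁ h₂ h₃
  simp [cnD_apply, h₁, h₂, h₃]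

lemma cnD0_cnD (hmm : ∀ kk, (m kk).comp (m (kk + 1)) = 0)
    (hq : ∀ kk, (q kk).comp (d kk) = (m kk).comp (q (kk + 1)))
    (z : F 1 × G 2) : cnD0 m q (cnD d m q 0 z) = 0 := by
  have h₂ := LinearMap.congr_fun (hmm 0) z.2
  have h₃ := LinearMap.congr_fun (hq 0) z.1
  simp only [LinearMap.comp_apply, LinearMap.zero_apply] at h₂ h₃
  simp [cnD_apply, cnD0, h₂, h₃]

lemma map_split_map
    (hσ : ∀ kk, (q (kk + 1)).comp ((σ (kk + 1)).comp (q (kk + 1))) = q (kk + 1))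
    (kk : ℕ) (x : F (kk + 1)) : q (kk + 1) (σ (kk + 1) (q (kk + 1) x)) = q (kk + 1) x :=
  LinearMap.congr_fun (hσ kk) x

lemma map_normSplit
    (hσ : ∀ kk, (q (kk + 1)).comp ((σ (kk + 1)).comp (q (kk + 1))) = q (kk + 1))
    (kk : ℕ) (y : G (kk + 1)) :
    q (kk + 1) (normSplit q σ (kk + 1) y) = eMap q σ (kk + 1) y :=
  map_split_map hσ kk (σ (kk + 1) y)

lemma normSplit_map
    (hσ : ∀ kk, (q (kk + 1)).comp ((σ (kk + 1)).comp (q (kk + 1))) = q (kk + 1))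
    (kk : ℕ) (x : F (kk + 1)) :
    normSplit q σ (kk + 1) (q (kk + 1) x) = σ (kk + 1) (q (kk + 1) x) :=
  congrArg (σ (kk + 1)) (map_split_map hσ kk x)

lemma eMap_eMap
    (hσ : ∀ kk, (q (kk + 1)).comp ((σ (kk + 1)).comp (q (kk + 1))) = q (kk + 1))
    (kk : ℕ) (y : G (kk + 1)) :
    eMap q σ (kk + 1) (eMap q σ (kk + 1) y) = eMap q σ (kk + 1) y :=
  map_split_map hσ kk (σ (kk + 1) y)

lemma normSplit_eMap
    (hσ : ∀ kk, (q (kk + 1)).comp ((σ (kk + 1)).comp (q (kk + 1))) = q (kk + 1))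
    (kk : ℕ) (y : G (kk + 1)) :
    normSplit q σ (kk + 1) (eMap q σ (kk + 1) y) = normSplit q σ (kk + 1) y :=
  congrArg (σ (kk + 1)) (eMap_eMap hσ kk y)

lemma eMap_one_apply
    (hσ : ∀ kk, (q (kk + 1)).comp ((σ (kk + 1)).comp (q (kk + 1))) = q (kk + 1))
    (hC1 : LinearMap.range (q 1) = ⊤) (y : G 1) : eMap q σ 1 y = y := by
  obtain ⟨x, rfl⟩ := LinearMap.range_eq_top.mp hC1 y
  exact map_split_map hσ 0 x

lemma coneHtpy_coneHtpy (kk : ℕ) (z : F kk × G (kk + 1)) :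
    coneHtpy q σ (kk + 1) (coneHtpy q σ kk z) = 0 := by
  simp [coneHtpy_apply]

lemma coneHtpy_cnD_coneHtpy
    (hσ : ∀ kk, (q (kk + 1)).comp ((σ (kk + 1)).comp (q (kk + 1))) = q (kk + 1))
    (kk : ℕ) (z : F kk × G (kk + 1)) :
    coneHtpy q σ kk (cnD d m q kk (coneHtpy q σ kk z)) = coneHtpy q σ kk z := by
  simp [coneHtpy_apply, cnD_apply, map_normSplit hσ, normSplit_eMap hσ]

lemma coneProj_zero_apply (z : F 0 × G 1) :
    coneProj d m q σ 0 z = cnD d m q 0 (coneHtpy q σ 0 z) := rfl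

lemma coneProj_succ_apply (j : ℕ) (z : F (j + 1) × G (j + 2)) :
    coneProj d m q σ (j + 1) z =
      cnD d m q (j + 1) (coneHtpy q σ (j + 1) z) + coneHtpy q σ j (cnD d m q j z) := rfl

lemma coneProj_isIdempotentElem (hdd : ∀ kk, (d kk).comp (d (kk + 1)) = 0)
    (hmm : ∀ kk, (m kk).comp (m (kk + 1)) = 0)
    (hq : ∀ kk, (q kk).comp (d kk) = (m kk).comp (q (kk + 1)))
    (hσ : ∀ kk, (q (kk + 1)).comp ((σ (kk + 1)).comp (q (kk + 1))) = q (kk + 1))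
    (kk : ℕ) : IsIdempotentElem (coneProj d m q σ kk) := by
  refine LinearMap.ext fun z => ?_
  cases kk <;>
    simp only [Module.End.mul_apply, coneProj_zero_apply, coneProj_succ_apply, map_add,
      coneHtpy_cnD_coneHtpy hσ, cnD_cnD hdd hmm hq, coneHtpy_coneHtpy, map_zero, add_zero,
      zero_add]

lemma cnD_coneProj (hdd : ∀ kk, (d kk).comp (d (kk + 1)) = 0)
    (hmm : ∀ kk, (m kk).comp (m (kk + 1)) = 0)
    (hq : ∀ kk, (q kk).comp (d kk) = (m kk).comp (q (kk + 1)))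
    (kk : ℕ) (z : F (kk + 1) × G (kk + 2)) :
    cnD d m q kk (coneProj d m q σ (kk + 1) z) = coneProj d m q σ kk (cnD d m q kk z) := by
  cases kk <;>
    simp only [coneProj_zero_apply, coneProj_succ_apply, map_add,
      cnD_cnD hdd hmm hq, map_zero, add_zero, zero_add]

lemma coneProj_coneHtpy
    (hσ : ∀ kk, (q (kk + 1)).comp ((σ (kk + 1)).comp (q (kk + 1))) = q (kk + 1))
    (kk : ℕ) (z : F kk × G (kk + 1)) :
    coneProj d m q σ (kk + 1) (coneHtpy q σ kk z) = coneHtpy q σ kk z := by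
  simp only [coneProj_succ_apply, coneHtpy_coneHtpy, coneHtpy_cnD_coneHtpy hσ, map_zero, zero_add]

lemma mem_ker_coneProj_zero
    (hσ : ∀ kk, (q (kk + 1)).comp ((σ (kk + 1)).comp (q (kk + 1))) = q (kk + 1))
    (hC1 : LinearMap.range (q 1) = ⊤) (z : F 0 × G 1) :
    z ∈ LinearMap.ker (coneProj d m q σ 0) ↔ z.2 = 0 := by
  have h := map_normSplit hσ 0 z.2
  simp only [eMap_one_apply hσ hC1] at h
  simp only [LinearMap.mem_ker, coneProj_zero_apply, coneHtpy_apply, cnD_apply, map_zero,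
    sub_zero, h, Prod.mk_eq_zero]
  exact ⟨And.right, fun h' => by simp [h']⟩

lemma mem_ker_coneProj_succ
    (hσ : ∀ kk, (q (kk + 1)).comp ((σ (kk + 1)).comp (q (kk + 1))) = q (kk + 1))
    (j : ℕ) (z : F (j + 1) × G (j + 2)) :
    z ∈ LinearMap.ker (coneProj d m q σ (j + 1)) ↔ eMap q σ (j + 2) z.2 = 0 ∧
      σ (j + 1) (q (j + 1) z.1) = normSplit q σ (j + 1) (m (j + 1) z.2) := by
  have h := map_normSplit hσ (j + 1) z.2
  have h' : eMap q σ (j + 2) z.2 = 0 → normSplit q σ (j + 2) z.2 = 0 := fun h₀ => by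
    simp [normSplit, h₀]
  simp only [LinearMap.mem_ker, coneProj_succ_apply, coneHtpy_apply, cnD_apply, map_zero,
    sub_zero, h, map_sub, normSplit_map hσ, Prod.mk_add_mk, Prod.mk_eq_zero, add_zero]
  constructor
  · rintro ⟨h₁, h₂⟩
    rw [h' h₂, map_zero, zero_add, sub_eq_zero] at h₁
    exact ⟨h₂, h₁⟩
  · rintro ⟨h₂, h₁⟩
    rw [h' h₂, map_zero, zero_add, sub_eq_zero]
    exact ⟨h₁, h₂⟩

lemma toDObj_bijective
    (hσ : ∀ kk, (q (kk + 1)).comp ((σ (kk + 1)).comp (q (kk + 1))) = q (kk + 1))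
    (hC1 : LinearMap.range (q 1) = ⊤) (kk : ℕ) :
    Function.Bijective ((toDObj q σ hσ kk).domRestrict
      (LinearMap.ker (coneProj d m q σ kk))) := by
  cases kk with
  | zero =>
    constructor
    · rintro ⟨z, hz⟩ ⟨w, hw⟩ hzw
      rw [mem_ker_coneProj_zero hσ hC1] at hz hw
      exact Subtype.ext (Prod.ext hzw (hz.trans hw.symm))
    · intro x
      exact ⟨⟨(x, 0), (mem_ker_coneProj_zero hσ hC1 _).mpr rfl⟩, rfl⟩
  | succ j =>
    constructor
    · rintro ⟨z, hz⟩ ⟨w, hw⟩ hzw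
      rw [mem_ker_coneProj_succ hσ] at hz hw
      have h₁ : z.1 - σ (j + 1) (q (j + 1) z.1) = w.1 - σ (j + 1) (q (j + 1) w.1) :=
        congrArg (fun p => (Prod.fst p).1) hzw
      have h₂ : z.2 - eMap q σ (j + 2) z.2 = w.2 - eMap q σ (j + 2) w.2 :=
        congrArg (fun p => (Prod.snd p).1) hzw
      rw [hz.1, hw.1, sub_zero, sub_zero] at h₂
      rw [hz.2, hw.2, h₂, sub_left_inj] at h₁
      exact Subtype.ext (Prod.ext h₁ h₂)
    · rintro ⟨⟨a, ha⟩, ⟨c, hc⟩⟩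
      rw [LinearMap.mem_ker] at ha hc
      have h : σ (j + 1) (q (j + 1) (a + normSplit q σ (j + 1) (m (j + 1) c))) =
          normSplit q σ (j + 1) (m (j + 1) c) := by
        rw [map_add, ha, zero_add, map_normSplit hσ]
        rfl
      refine ⟨⟨(a + normSplit q σ (j + 1) (m (j + 1) c), c),
        (mem_ker_coneProj_succ hσ j _).mpr ⟨hc, h⟩⟩, Prod.ext (Subtype.ext ?_) (Subtype.ext ?_)⟩
      · exact sub_eq_of_eq_add (congrArg (a + ·) h.symm)
      · change c - eMap q σ (j + 2) c = c
        rw [hc, sub_zero]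

lemma Dd_toDObj
    (hq : ∀ kk, (q kk).comp (d kk) = (m kk).comp (q (kk + 1)))
    (hσ : ∀ kk, (q (kk + 1)).comp ((σ (kk + 1)).comp (q (kk + 1))) = q (kk + 1))
    (kk : ℕ) (z : F (kk + 1) × G (kk + 2))
    (hz : z ∈ LinearMap.ker (coneProj d m q σ (kk + 1))) :
    Dd d m q σ hq hσ kk (toDObj q σ hσ (kk + 1) z) = toDObj q σ hσ kk (cnD d m q kk z) := by
  rw [mem_ker_coneProj_succ hσ] at hz
  have hy : piC q σ hσ (kk + 1) z.2 = ⟨z.2, hz.1⟩ :=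
    Subtype.ext (by change z.2 - eMap q σ (kk + 2) z.2 = z.2; rw [hz.1, sub_zero])
  have hx : d kk (z.1 - σ (kk + 1) (q (kk + 1) z.1)) +
      d kk (normSplit q σ (kk + 1) (m (kk + 1) z.2)) = d kk z.1 := by
    rw [← map_add, hz.2, sub_add_cancel]
  have hqx : q (kk + 1) z.1 = eMap q σ (kk + 1) (m (kk + 1) z.2) := by
    rw [← map_split_map hσ kk z.1, hz.2, map_normSplit hσ]
  have hD : toDObj q σ hσ (kk + 1) z = (piA q σ hσ kk z.1, ⟨z.2, hz.1⟩) :=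
    Prod.ext rfl hy
  rw [hD, cnD_apply]
  cases kk with
  | zero => exact hx
  | succ j =>
    refine Prod.ext ?_ (Subtype.ext ?_)
    · have hA : piA q σ hσ j (d (j + 1) (piA q σ hσ (j + 1) z.1).1) =
          dA d m q hq j (piA q σ hσ (j + 1) z.1) := by
        refine Subtype.ext ?_
        have h : q (j + 1) (d (j + 1) (piA q σ hσ (j + 1) z.1).1) = 0 :=
          (dA d m q hq j (piA q σ hσ (j + 1) z.1)).2
        change d (j + 1) (piA q σ hσ (j + 1) z.1).1 - σ (j + 1) (q (j + 1) _) = _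
        rw [h, map_zero, sub_zero]
        rfl
      have h := congrArg (piA q σ hσ j) hx
      rw [map_add] at h
      exact (congrArg (· + _) hA.symm).trans h
    · change -(m (j + 2) z.2 - eMap q σ (j + 2) (m (j + 2) z.2)) =
        (q (j + 2) z.1 - m (j + 2) z.2) - eMap q σ (j + 2) (q (j + 2) z.1 - m (j + 2) z.2)
      rw [hqx, map_sub, eMap_eMap hσ]
      abel

end

/-- Miller–Rahmati, Theorem `thm:splitMappingCone`.
Given complexes of free modules `F_•` (augmented by `q 0 = d_0 : F 0 → G 0 = R`)
and `G_•`, a chain map `q`, splittings `σ` of each `q_k` (`k ≥ 1`) — encoding that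
`0 → ker q_k → F_k → im q_k → 0` and `0 → im q_k → G_k → coker q_k → 0` are split —
and `coker q_1 = 0`, the mapping cone of `q` is the direct sum of a split exact
(contractible) subcomplex `S` and a subcomplex `T` isomorphic, as a complex, to the
complex `D` with terms `A_{k−1} ⊕ C_k` and differential `[[d, Θ], [0, −m̄]]`. -/
theorem stmt_11
    [∀ kk, Module.Free R (F kk)] [∀ kk, Module.Free R (G kk)]
    (hdd : ∀ kk, (d kk).comp (d (kk + 1)) = 0)
    (hmm : ∀ kk, (m kk).comp (m (kk + 1)) = 0)
    (hq : ∀ kk, (q kk).comp (d kk) = (m kk).comp (q (kk + 1)))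
    (hσ : ∀ kk, (q (kk + 1)).comp ((σ (kk + 1)).comp (q (kk + 1))) = q (kk + 1))
    (hC1 : LinearMap.range (q 1) = ⊤) :
    ∃ (S T : ∀ kk, Submodule R (F kk × G (kk + 1)))
      (_hSinv : ∀ kk, Submodule.map (cnD d m q kk) (S (kk + 1)) ≤ S kk)
      (hTinv : ∀ kk, Submodule.map (cnD d m q kk) (T (kk + 1)) ≤ T kk),
      -- the cone is the internal direct sum of the subcomplexes `S` and `T`
      (∀ kk, IsCompl (S kk) (T kk)) ∧
      -- `S` dies at the bottom of the cone (its degree-0 part is `0`)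
      (∀ z ∈ S 0, cnD0 m q z = 0) ∧
      -- `S` is split exact: it carries a contracting homotopy
      (∃ h : ∀ kk, (F kk × G (kk + 1)) →ₗ[R] (F (kk + 1) × G (kk + 2)),
        (∀ kk, ∀ z ∈ S kk, h kk z ∈ S (kk + 1)) ∧
        (∀ z ∈ S 0, cnD d m q 0 (h 0 z) = z) ∧
        (∀ kk, ∀ z ∈ S (kk + 1),
          cnD d m q (kk + 1) (h (kk + 1) z) + h kk (cnD d m q kk z) = z)) ∧
      -- `T` is isomorphic, as a complex, to `D`
      (∃ ψ : ∀ kk, ↥(T kk) →ₗ[R] DObj q σ kk,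
        (∀ kk, Function.Bijective (ψ kk)) ∧
        (∀ kk (z : ↥(T (kk + 1))),
          Dd d m q σ hq hσ kk (ψ (kk + 1) z) =
            ψ kk ⟨cnD d m q kk z.1,
              hTinv kk (Submodule.mem_map_of_mem z.2)⟩) ∧
        -- compatibility at the bottom: under `ψ 0 : T 0 ≃ D_1 = F 0`, the cone
        -- augmentation agrees with the bottom map `q 0 = d_0 : F 0 → G 0` of `D`
        (∀ z : ↥(T 0), cnD0 m q z.1 = q 0 (ψ 0 z))) := by
  have hidem := fun kk => coneProj_isIdempotentElem hdd hmm hq hσ kk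
  have hfix : ∀ kk, ∀ z ∈ LinearMap.range (coneProj d m q σ kk),
      coneProj d m q σ kk z = z := by
    rintro kk _ ⟨w, rfl⟩
    exact LinearMap.congr_fun (hidem kk) w
  refine ⟨fun kk => LinearMap.range (coneProj d m q σ kk),
    fun kk => LinearMap.ker (coneProj d m q σ kk), ?_, ?_, fun kk => ?_, ?_,
    ⟨coneHtpy q σ, ?_, ?_, ?_⟩,
    ⟨fun kk => (toDObj q σ hσ kk).domRestrict _, toDObj_bijective hσ hC1, ?_, ?_⟩⟩
  · rintro kk _ ⟨_, ⟨w, rfl⟩, rfl⟩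
    exact ⟨_, (cnD_coneProj hdd hmm hq kk w).symm⟩
  · rintro kk _ ⟨w, hw, rfl⟩
    rw [SetLike.mem_coe, LinearMap.mem_ker] at hw
    rw [LinearMap.mem_ker, ← cnD_coneProj hdd hmm hq, hw, map_zero]
  · exact (LinearMap.IsIdempotentElem.isCompl (hidem kk))
  · rintro _ ⟨w, rfl⟩
    exact cnD0_cnD hmm hq _
  · exact fun kk z _ => ⟨_, coneProj_coneHtpy hσ kk z⟩
  · exact hfix 0
  · exact fun kk => hfix (kk + 1)
  · exact fun kk z => Dd_toDObj hq hσ kk z.1 z.2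
  · intro z
    have hz := (mem_ker_coneProj_zero hσ hC1 z.1).mp z.2
    change q 0 z.1.1 + -(m 0) z.1.2 = q 0 z.1.1
    rw [hz, map_zero, neg_zero, add_zero]

end Stmt11
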